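/- If p ∈ 𝓑_M(ℝ) and a ∈ L^∞(ℝ,V(ℝ)), then the pseudodifferential operator a(x,D), defined for f ∈ C_0^∞(ℝ) by the iterated integral (a(x,D)f)(x) := (1/2π) ∫_ℝ dλ ∫_ℝ a(x,λ) e^{i(x−y)λ} f(y) dy, extends to a bounded linear operator on L^{p(·)}(ℝ) with ‖a(x,D)‖_{𝓑(L^{p(·)}(ℝ))} ≤ 2 ‖S_*‖_{𝓑(L^{p(·)}(ℝ))} ‖a‖_{L^∞(ℝ,V(ℝ))}, where S_* is the (bounded extension of the) maximal singular integral operator (S_* f)(x) := sup_{−∞<a<b<+∞} |(1/2π) ∫_a^b f̂(λ) e^{ixλ} dλ|. -/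

import Mathlib

open MeasureTheory Filter Set Topology
open scoped ENNReal NNReal

noncomputable section

/-- The norm of the variable Lebesgue space `L^{p(·)}`, applied to an
`ℝ≥0∞`-valued function. -/
def vNorm {α : Type*} [MeasureSpace α] (p : α → ℝ) (g : α → ℝ≥0∞) : ℝ≥0∞ :=
  sInf {lam : ℝ≥0∞ | 0 < lam ∧ (∫⁻ x, (g x / lam) ^ (p x)) ≤ 1}

/-- The norm of a complex-valued function in the variable Lebesgue space `L^{p(·)}`. -/
def vNormC {α : Type*} [MeasureSpace α] (p : α → ℝ) (f : α → ℂ) : ℝ≥0∞ :=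
  vNorm p (fun x => (‖f x‖₊ : ℝ≥0∞))

/-- The Hardy–Littlewood maximal operator on `ℝ` (supremum of averages over
all intervals containing the point). -/
def maximal1 (g : ℝ → ℝ≥0∞) (x : ℝ) : ℝ≥0∞ :=
  ⨆ (a : ℝ) (l : ℝ) (_ : 0 < l) (_ : x ∈ Icc a (a + l)),
    (volume (Icc a (a + l)))⁻¹ * ∫⁻ y in Icc a (a + l), g y

/-- The class `𝓑_M(ℝ)`: measurable exponents `p` with `1 < ess inf p` and
`ess sup p < ∞` such that the Hardy–Littlewood maximal operator is bounded
on `L^{p(·)}(ℝ)`. -/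
def MemBM1 (p : ℝ → ℝ) : Prop :=
  Measurable p ∧ (∃ c : ℝ, 1 < c ∧ ∀ᵐ x ∂volume, c ≤ p x) ∧
    (∃ C : ℝ, ∀ᵐ x ∂volume, p x ≤ C) ∧
    ∃ C : ℝ≥0, ∀ f : ℝ → ℂ,
      vNorm p (maximal1 fun x => (‖f x‖₊ : ℝ≥0∞)) ≤ C * vNormC p f

/-- The Fourier transform `f̂(λ) = ∫ f(x) e^{-ixλ} dx`. -/
def ftransform (f : ℝ → ℂ) (l : ℝ) : ℂ :=
  ∫ x : ℝ, f x * Complex.exp (-(Complex.I * (x : ℂ) * (l : ℂ)))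

/-- The truncated Fourier inversion integral `(S_{(a,b)}f)(x) = (1/2π) ∫_a^b f̂(λ) e^{ixλ} dλ`. -/
def SInt (a b : ℝ) (f : ℝ → ℂ) (x : ℝ) : ℂ :=
  (2 * Real.pi)⁻¹ • ∫ l in a..b, ftransform f l * Complex.exp (Complex.I * (x : ℂ) * (l : ℂ))

/-- The maximal singular integral operator `(S_* f)(x) = sup_{a<b} |(S_{(a,b)}f)(x)|`. -/
def Sstar (f : ℝ → ℂ) (x : ℝ) : ℝ≥0∞ :=
  ⨆ (a : ℝ) (b : ℝ) (_ : a < b), (‖SInt a b f x‖₊ : ℝ≥0∞)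

/-- Total variation of `u` over partitions with nodes in the set `s`. -/
def varOn (u : ℝ → ℂ) (s : Set ℝ) : ℝ≥0∞ :=
  ⨆ (m : ℕ) (x : Fin (m + 1) → ℝ) (_ : StrictMono x) (_ : ∀ k, x k ∈ s),
    ∑ k : Fin m, (‖u (x k.succ) - u (x k.castSucc)‖₊ : ℝ≥0∞)

/-- The total variation `V(u)` of `u` on `ℝ`. -/
def totalVar (u : ℝ → ℂ) : ℝ≥0∞ := varOn u Set.univ

/-- The norm `‖u‖_V = ‖u‖_∞ + V(u)` of the Banach algebra `V(ℝ)`. -/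
def bvNorm (u : ℝ → ℂ) : ℝ≥0∞ := (⨆ t : ℝ, (‖u t‖₊ : ℝ≥0∞)) + totalVar u

/-- Membership in `V(ℝ)`: finite total variation and left continuity. -/
def MemV (u : ℝ → ℂ) : Prop :=
  totalVar u < ∞ ∧ ∀ t : ℝ, Tendsto u (𝓝[<] t) (𝓝 (u t))

/-- Membership in `L^∞(ℝ, V(ℝ))`: every section `a(x,·)` lies in `V(ℝ)`, the map
`x ↦ a(x,·)` is essentially bounded and measurable in the sense of the Luzin property. -/
def MemLinfV (a : ℝ → ℝ → ℂ) : Prop :=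
  (∀ x, MemV (a x)) ∧
  (∃ C : ℝ≥0, ∀ᵐ x ∂(volume : Measure ℝ), bvNorm (a x) ≤ C) ∧
  (∀ K : Set ℝ, IsCompact K → ∀ δ : ℝ≥0∞, 0 < δ → ∃ K' ⊆ K, IsCompact K' ∧
    volume (K \ K') < δ ∧ ∀ x ∈ K', ∀ ε : ℝ≥0∞, 0 < ε → ∃ η > (0 : ℝ), ∀ x' ∈ K',
      |x' - x| < η → bvNorm (fun t => a x t - a x' t) < ε)

/-- The norm `‖a‖_{L^∞(ℝ,V(ℝ))} = ess sup_x ‖a(x,·)‖_V`. -/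
def LinfVNorm (a : ℝ → ℝ → ℂ) : ℝ≥0∞ := essSup (fun x => bvNorm (a x)) volume

/-- The pseudodifferential operator
`(a(x,D)f)(x) = (1/2π) ∫ dλ ∫ a(x,λ) e^{i(x-y)λ} f(y) dy` (iterated integral). -/
def pdo (a : ℝ → ℝ → ℂ) (f : ℝ → ℂ) (x : ℝ) : ℂ :=
  (2 * Real.pi)⁻¹ •
    ∫ l : ℝ, ∫ y : ℝ, a x l * Complex.exp (Complex.I * ((x : ℂ) - (y : ℂ)) * (l : ℂ)) * f y

section Abel

lemma sum_mul_sub_eq_abel (c h : ℕ → ℂ) (h0 : h 0 = 0) (M : ℕ) :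
    ∑ k ∈ Finset.range (M + 1), c k * (h (k + 1) - h k) =
      c M * h (M + 1) - ∑ k ∈ Finset.range M, (c (k + 1) - c k) * h (k + 1) := by
  induction M with
  | zero => simp [h0]
  | succ M ih =>
    rw [Finset.sum_range_succ, ih, Finset.sum_range_succ _ M]
    ring

lemma norm_sum_mul_sub_le (c h : ℕ → ℂ) (h0 : h 0 = 0) {B C V : ℝ} (hB : ∀ k, ‖h k‖ ≤ B)
    (hC : ∀ k, ‖c k‖ ≤ C) (hV : ∀ M, ∑ k ∈ Finset.range M, ‖c (k + 1) - c k‖ ≤ V) (M : ℕ) :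
    ‖∑ k ∈ Finset.range M, c k * (h (k + 1) - h k)‖ ≤ (C + V) * B := by
  have hB0 : 0 ≤ B := (norm_nonneg _).trans (hB 0)
  have hC0 : 0 ≤ C := (norm_nonneg _).trans (hC 0)
  have hV0 : 0 ≤ V := by simpa using hV 0
  cases M with
  | zero => simpa using mul_nonneg (add_nonneg hC0 hV0) hB0
  | succ M =>
    rw [sum_mul_sub_eq_abel c h h0]
    calc ‖c M * h (M + 1) - ∑ k ∈ Finset.range M, (c (k + 1) - c k) * h (k + 1)‖
        ≤ ‖c M * h (M + 1)‖ + ‖∑ k ∈ Finset.range M, (c (k + 1) - c k) * h (k + 1)‖ :=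
          norm_sub_le _ _
      _ ≤ C * B + ∑ k ∈ Finset.range M, ‖c (k + 1) - c k‖ * B := by
          gcongr ?_ + ?_
          · rw [norm_mul]
            exact mul_le_mul (hC _) (hB _) (norm_nonneg _) hC0
          · refine (norm_sum_le _ _).trans (Finset.sum_le_sum fun k _ => ?_)
            rw [norm_mul]
            exact mul_le_mul_of_nonneg_left (hB _) (norm_nonneg _)
      _ ≤ (C + V) * B := by
          rw [← Finset.sum_mul, add_mul]
          gcongr
          exact hV M

end Abel

section StepApproximation

/-- The left endpoint of the cell `(k/m, (k+1)/m]` containing `l`. -/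
def gridLeft (m : ℕ) (l : ℝ) : ℝ := (⌈l * m⌉ - 1) / m

lemma gridLeft_lt {m : ℕ} (hm : 0 < m) (l : ℝ) : gridLeft m l < l := by
  have hm' : (0 : ℝ) < m := by exact_mod_cast hm
  rw [gridLeft, div_lt_iff₀ hm']
  linarith [Int.ceil_lt_add_one (l * m)]

lemma le_gridLeft_add {m : ℕ} (hm : 0 < m) (l : ℝ) : l - 1 / m ≤ gridLeft m l := by
  have hm' : (0 : ℝ) < m := by exact_mod_cast hm
  rw [gridLeft, le_div_iff₀ hm', sub_mul, one_div, inv_mul_cancel₀ hm'.ne']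
  linarith [Int.le_ceil (l * m)]

lemma tendsto_gridLeft (l : ℝ) :
    Tendsto (fun n : ℕ => gridLeft (n + 1) l) atTop (𝓝[<] l) := by
  rw [tendsto_nhdsWithin_iff]
  refine ⟨?_, .of_forall fun n => gridLeft_lt n.succ_pos l⟩
  have h : Tendsto (fun n : ℕ => l - 1 / ((n + 1 : ℕ) : ℝ)) atTop (𝓝 l) := by
    have := (tendsto_const_nhds (x := l)).sub (tendsto_one_div_add_atTop_nhds_zero_nat (𝕜 := ℝ))
    simpa using this
  exact tendsto_of_tendsto_of_tendsto_of_le_of_le h tendsto_const_nhds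
    (fun n => le_gridLeft_add n.succ_pos l) (fun n => (gridLeft_lt n.succ_pos l).le)

/-- The nodes `-m + k/m`. -/
def gridNode (m k : ℕ) : ℝ := -m + k / m

lemma gridNode_strictMono {m : ℕ} (hm : 0 < m) : StrictMono (gridNode m) := by
  intro i j hij
  have hm' : (0 : ℝ) < m := by exact_mod_cast hm
  unfold gridNode
  gcongr

lemma gridLeft_eq_gridNode {m : ℕ} (hm : 0 < m) {k : ℕ} {l : ℝ}
    (hl : l ∈ Ioc (gridNode m k) (gridNode m (k + 1))) : gridLeft m l = gridNode m k := by
  have hm' : (0 : ℝ) < m := by exact_mod_cast hm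
  have e (j : ℕ) : gridNode m j * m = -(m * m) + j := by
    unfold gridNode
    field_simp
  have h1 := mul_lt_mul_of_pos_right hl.1 hm'
  have h2 := mul_le_mul_of_nonneg_right hl.2 hm'.le
  rw [e] at h1 h2
  have h3 : ⌈l * m⌉ = -((m : ℤ) * m) + k + 1 := by
    rw [Int.ceil_eq_iff]
    push_cast at h2 ⊢
    constructor <;> linarith
  rw [gridLeft, h3, div_eq_iff hm'.ne', e]
  push_cast
  ring

lemma integral_gridLeft_mul {u F : ℝ → ℂ} (hF : Integrable F) {m : ℕ} (hm : 0 < m) (M : ℕ) :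
    ∫ l in gridNode m 0..gridNode m M, u (gridLeft m l) * F l =
      ∑ k ∈ Finset.range M, u (gridNode m k) *
        ((∫ l in gridNode m 0..gridNode m (k + 1), F l) -
          ∫ l in gridNode m 0..gridNode m k, F l) := by
  have hmono := (gridNode_strictMono hm).monotone
  have hcell (k : ℕ) : EqOn (fun l => u (gridLeft m l) * F l) (fun l => u (gridNode m k) * F l)
      (Set.uIoc (gridNode m k) (gridNode m (k + 1))) := by
    intro l hl
    rw [uIoc_of_le (hmono k.le_succ)] at hl
    simp only [gridLeft_eq_gridNode hm hl]
  have hint (k : ℕ) : IntervalIntegrable (fun l => u (gridLeft m l) * F l) volume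
      (gridNode m k) (gridNode m (k + 1)) :=
    (hF.intervalIntegrable.const_mul (u (gridNode m k))).congr (hcell k).symm
  rw [← intervalIntegral.sum_integral_adjacent_intervals fun k _ => hint k]
  refine Finset.sum_congr rfl fun k _ => ?_
  rw [intervalIntegral.integral_interval_sub_left hF.intervalIntegrable hF.intervalIntegrable,
    ← intervalIntegral.integral_const_mul]
  exact intervalIntegral.integral_congr_ae (.of_forall fun l hl => hcell k hl)

/-- A left-continuous multiplier of bounded variation is controlled by the integrals of `F` over
bounded intervals. -/
lemma norm_integral_mul_le_of_variation {u F : ℝ → ℂ} (hF : Integrable F)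
    (hu : ∀ t, Tendsto u (𝓝[<] t) (𝓝 (u t))) {B C V : ℝ} (hC : ∀ t, ‖u t‖ ≤ C)
    (hV : ∀ t : ℕ → ℝ, StrictMono t → ∀ M, ∑ k ∈ Finset.range M, ‖u (t (k + 1)) - u (t k)‖ ≤ V)
    (hB : ∀ a b, a < b → ‖∫ l in a..b, F l‖ ≤ B) :
    ‖∫ l, u l * F l‖ ≤ (C + V) * B := by
  have hB0 : 0 ≤ B := (norm_nonneg _).trans (hB 0 1 one_pos)
  set Φ : ℕ → ℝ → ℂ := fun n =>
    (Ioc (-((n + 1 : ℕ) : ℝ)) (n + 1 : ℕ)).indicator fun l => u (gridLeft (n + 1) l) * F l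
    with hΦ
  have hmeas (n : ℕ) : AEStronglyMeasurable (Φ n) := by
    refine AEStronglyMeasurable.indicator (AEStronglyMeasurable.mul ?_ hF.1) measurableSet_Ioc
    have h : Measurable fun z : ℤ => u (((z : ℝ) - 1) / (n + 1 : ℕ)) := measurable_from_top
    exact (h.comp (Int.measurable_ceil.comp (measurable_id.mul_const _))).aestronglyMeasurable
  have hlim : Tendsto (fun n => ∫ l, Φ n l) atTop (𝓝 (∫ l, u l * F l)) := by
    refine tendsto_integral_of_dominated_convergence (fun l => C * ‖F l‖) hmeas
      (hF.norm.const_mul C) (fun n => .of_forall fun l => ?_) (.of_forall fun l => ?_)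
    · refine (norm_indicator_le_norm_self _ _).trans ?_
      rw [norm_mul]
      exact mul_le_mul_of_nonneg_right (hC _) (norm_nonneg _)
    · have h : Tendsto (fun n : ℕ => u (gridLeft (n + 1) l) * F l) atTop (𝓝 (u l * F l)) :=
        ((hu l).comp (tendsto_gridLeft l)).mul_const _
      refine h.congr' ?_
      obtain ⟨N, hN⟩ := exists_nat_gt |l|
      filter_upwards [eventually_ge_atTop N] with n hn
      have hn' : (N : ℝ) ≤ n := by exact_mod_cast hn
      obtain ⟨h1, h2⟩ := abs_lt.1 hN
      rw [hΦ]
      have hmem : l ∈ Ioc (-((n + 1 : ℕ) : ℝ)) (n + 1 : ℕ) := by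
        push_cast
        constructor <;> linarith
      exact (indicator_of_mem hmem fun l => u (gridLeft (n + 1) l) * F l).symm
  refine le_of_tendsto hlim.norm (.of_forall fun n => ?_)
  have hm : 0 < n + 1 := n.succ_pos
  have hm' : ((n + 1 : ℕ) : ℝ) ≠ 0 := by positivity
  have e0 : gridNode (n + 1) 0 = -((n + 1 : ℕ) : ℝ) := by simp [gridNode]
  have e1 : gridNode (n + 1) (2 * (n + 1) * (n + 1)) = ((n + 1 : ℕ) : ℝ) := by
    rw [gridNode, Nat.cast_mul, mul_div_cancel_right₀ _ hm']
    push_cast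
    ring
  have hle : -((n + 1 : ℕ) : ℝ) ≤ (n + 1 : ℕ) := by
    have : (0 : ℝ) ≤ (n + 1 : ℕ) := by positivity
    linarith
  rw [hΦ, integral_indicator measurableSet_Ioc, ← intervalIntegral.integral_of_le hle]
  nth_rewrite 1 [← e0]
  rw [← e1, integral_gridLeft_mul hF hm]
  have hmono := gridNode_strictMono hm
  refine norm_sum_mul_sub_le (fun k => u (gridNode (n + 1) k))
    (fun k => ∫ l in gridNode (n + 1) 0..gridNode (n + 1) k, F l) (by simp) (fun k => ?_)
    (fun k => hC _) (hV _ hmono) _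
  rcases Nat.eq_zero_or_pos k with rfl | hk
  · simpa using hB0
  · exact hB _ _ (hmono hk)

end StepApproximation

section PointwiseBound

lemma sum_enorm_sub_le_totalVar (u : ℝ → ℂ) {t : ℕ → ℝ} (ht : StrictMono t) (M : ℕ) :
    ∑ k ∈ Finset.range M, ‖u (t (k + 1)) - u (t k)‖ₑ ≤ totalVar u := by
  rw [← Fin.sum_univ_eq_sum_range fun k => ‖u (t (k + 1)) - u (t k)‖ₑ]
  unfold totalVar varOn
  refine le_iSup_of_le M <| le_iSup_of_le (fun k => t k) <|
    le_iSup_of_le (fun i j hij => ht hij) <| le_iSup_of_le (fun k => mem_univ _) ?_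
  simp [enorm_eq_nnnorm]

lemma ftransform_eq_fourier (f : ℝ → ℂ) (l : ℝ) :
    ftransform f l = FourierTransform.fourier f (l * (2 * Real.pi)⁻¹) := by
  rw [Real.fourier_real_eq_integral_exp_smul]
  unfold ftransform
  refine integral_congr_ae (.of_forall fun y => ?_)
  simp only [smul_eq_mul]
  rw [mul_comm]
  congr 2
  have : (Real.pi : ℂ) ≠ 0 := by exact_mod_cast Real.pi_ne_zero
  push_cast
  field_simp

lemma integrable_ftransform {f : ℝ → ℂ} (hf : ContDiff ℝ (⊤ : ℕ∞) f) (hc : HasCompactSupport f) :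
    Integrable (ftransform f) := by
  have h := (FourierTransform.fourier (hc.toSchwartzMap hf)).integrable (μ := volume)
  have h2 := h.comp_mul_right' (R := (2 * Real.pi)⁻¹) (by positivity)
  refine h2.congr (.of_forall fun l => ?_)
  rw [ftransform_eq_fourier]
  rfl

lemma integrable_ftransform_mul_exp {f : ℝ → ℂ} (hf : Integrable (ftransform f)) (x : ℝ) :
    Integrable fun l : ℝ => ftransform f l * Complex.exp (Complex.I * (x : ℂ) * (l : ℂ)) := by
  refine hf.mul_bdd (c := 1) (by fun_prop) (.of_forall fun l => ?_)
  rw [show Complex.I * (x : ℂ) * (l : ℂ) = ((x * l : ℝ) : ℂ) * Complex.I by push_cast; ring,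
    Complex.norm_exp_ofReal_mul_I]

lemma pdo_eq_integral_ftransform (a : ℝ → ℝ → ℂ) (f : ℝ → ℂ) (x : ℝ) :
    pdo a f x = (2 * Real.pi)⁻¹ • ∫ l : ℝ, a x l *
      (ftransform f l * Complex.exp (Complex.I * (x : ℂ) * (l : ℂ))) := by
  unfold pdo ftransform
  congr 2
  ext l
  rw [← integral_mul_const, ← integral_const_mul]
  congr 1
  ext y
  rw [show Complex.I * ((x : ℂ) - y) * l = Complex.I * x * l + -(Complex.I * y * l) by ring,
    Complex.exp_add]
  ring

lemma enorm_pdo_le {a : ℝ → ℝ → ℂ} {f : ℝ → ℂ} (hf : Integrable (ftransform f)) {x : ℝ}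
    (hu : ∀ t, Tendsto (a x) (𝓝[<] t) (𝓝 (a x t))) (hfin : bvNorm (a x) ≠ ∞) :
    ‖pdo a f x‖ₑ ≤ bvNorm (a x) * Sstar f x := by
  set F : ℝ → ℂ := fun l => ftransform f l * Complex.exp (Complex.I * (x : ℂ) * (l : ℂ))
  have hF : Integrable F := integrable_ftransform_mul_exp hf x
  have hπ : (0 : ℝ) < (2 * Real.pi)⁻¹ := by positivity
  obtain ⟨hCfin, hVfin⟩ := ENNReal.add_ne_top.1 hfin
  have hSfin : Sstar f x ≠ ∞ := by
    refine ne_top_of_le_ne_top (ENNReal.ofReal_ne_top (r := (2 * Real.pi)⁻¹ * ∫ l, ‖F l‖)) ?_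
    refine iSup_le fun b => iSup_le fun c => iSup_le fun hbc => ?_
    rw [← enorm_eq_nnnorm, ← ofReal_norm]
    refine ENNReal.ofReal_le_ofReal ?_
    rw [SInt, norm_smul, Real.norm_of_nonneg hπ.le]
    gcongr
    rw [intervalIntegral.integral_of_le hbc.le]
    exact (norm_integral_le_integral_norm _).trans
      (setIntegral_le_integral hF.norm (.of_forall fun _ => norm_nonneg _))
  have key : ‖∫ l, a x l * F l‖ ≤
      ((⨆ t : ℝ, (‖a x t‖₊ : ℝ≥0∞)).toReal + (totalVar (a x)).toReal) *
        (2 * Real.pi * (Sstar f x).toReal) := by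
    refine norm_integral_mul_le_of_variation hF hu (fun t => ?_) (fun t ht M => ?_)
      (fun b c hbc => ?_)
    · rw [← toReal_enorm]
      exact ENNReal.toReal_mono hCfin (le_iSup (fun t => (‖a x t‖₊ : ℝ≥0∞)) t)
    · have h := ENNReal.toReal_mono hVfin (sum_enorm_sub_le_totalVar (a x) ht M)
      rw [ENNReal.toReal_sum fun _ _ => enorm_ne_top] at h
      simpa only [toReal_enorm] using h
    · have h : ‖SInt b c f x‖ₑ ≤ Sstar f x :=
        le_iSup_of_le b <| le_iSup_of_le c <| le_iSup_of_le hbc le_rfl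
      have h' := ENNReal.toReal_mono hSfin h
      rw [toReal_enorm, SInt, norm_smul, Real.norm_of_nonneg hπ.le,
        inv_mul_le_iff₀ (by positivity)] at h'
      exact h'
  rw [← ENNReal.toReal_le_toReal enorm_ne_top (ENNReal.mul_ne_top hfin hSfin), toReal_enorm,
    ENNReal.toReal_mul, bvNorm, ENNReal.toReal_add hCfin hVfin, pdo_eq_integral_ftransform,
    norm_smul, Real.norm_of_nonneg hπ.le, inv_mul_le_iff₀ (by positivity)]
  linarith [key]

end PointwiseBound

section VariableNorm

lemma vNorm_mono_ae {p : ℝ → ℝ} (hp : ∀ᵐ x, 0 ≤ p x) {g h : ℝ → ℝ≥0∞}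
    (hgh : ∀ᵐ x, g x ≤ h x) : vNorm p g ≤ vNorm p h := by
  refine sInf_le_sInf fun lam hlam => ⟨hlam.1, (lintegral_mono_ae ?_).trans hlam.2⟩
  filter_upwards [hp, hgh] with x hx hx'
  gcongr

lemma vNorm_const_mul_le {p : ℝ → ℝ} (hp : ∀ᵐ x, 0 < p x) {A : ℝ≥0∞} (hA : A ≠ ∞)
    (g : ℝ → ℝ≥0∞) : vNorm p (fun x => A * g x) ≤ A * vNorm p g := by
  rcases eq_or_ne A 0 with rfl | hA0
  · rw [zero_mul]
    refine le_of_forall_gt_imp_ge_of_dense fun lam hlam => sInf_le ⟨hlam, ?_⟩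
    rw [lintegral_congr_ae (g := 0), lintegral_zero_fun]
    · exact zero_le_one
    · filter_upwards [hp] with x hx
      simp [hx]
  · rw [vNorm, vNorm, sInf_eq_iInf' {lam | 0 < lam ∧ (∫⁻ x, (g x / lam) ^ p x) ≤ 1},
      ENNReal.mul_iInf_of_ne hA0 hA]
    refine le_iInf fun lam => sInf_le ⟨ENNReal.mul_pos hA0 lam.2.1.ne', ?_⟩
    simp only [ENNReal.mul_div_mul_left _ _ hA0 hA]
    exact lam.2.2

end VariableNorm

/-- If `p ∈ 𝓑_M(ℝ)` and `a ∈ L^∞(ℝ, V(ℝ))`, then the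
pseudodifferential operator `a(x,D)` is bounded on `L^{p(·)}(ℝ)` with
`‖a(x,D)‖ ≤ 2 ‖S_*‖ ‖a‖_{L^∞(ℝ,V(ℝ))}`: for every bound `CS` for `S_*` on
`L^{p(·)}(ℝ)` one has `‖a(x,D) f‖_{p(·)} ≤ 2 CS ‖a‖ ‖f‖_{p(·)}` on `C_0^∞(ℝ)`. -/
theorem pdo_bounded_on_variable_Lp (p : ℝ → ℝ) (hp : MemBM1 p)
    (a : ℝ → ℝ → ℂ) (ha : MemLinfV a) :
    ∀ CS : ℝ≥0,
      (∀ f : ℝ → ℂ, ContDiff ℝ (⊤ : ℕ∞) f → HasCompactSupport f →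
        vNorm p (Sstar f) ≤ CS * vNormC p f) →
      ∀ f : ℝ → ℂ, ContDiff ℝ (⊤ : ℕ∞) f → HasCompactSupport f →
        vNormC p (pdo a f) ≤ 2 * (CS : ℝ≥0∞) * LinfVNorm a * vNormC p f := by
  intro CS hCS f hf hc
  obtain ⟨_, ⟨c, hc1, hcp⟩, _, _⟩ := hp
  obtain ⟨hV, ⟨C, hC⟩, _⟩ := ha
  have hpos : ∀ᵐ x, 0 < p x := hcp.mono fun x hx => by linarith
  have hA : LinfVNorm a ≠ ∞ :=
    ne_top_of_le_ne_top ENNReal.coe_ne_top (essSup_le_of_ae_le (C : ℝ≥0∞) hC)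
  have hbound : ∀ᵐ x, (‖pdo a f x‖₊ : ℝ≥0∞) ≤ LinfVNorm a * Sstar f x := by
    filter_upwards [hC, ENNReal.ae_le_essSup fun x => bvNorm (a x)] with x hx hx'
    exact (enorm_pdo_le (integrable_ftransform hf hc) (hV x).2
      (ne_top_of_le_ne_top ENNReal.coe_ne_top hx)).trans (mul_le_mul_left hx' _)
  calc vNormC p (pdo a f)
      ≤ vNorm p (fun x => LinfVNorm a * Sstar f x) :=
        vNorm_mono_ae (hpos.mono fun _ => le_of_lt) hbound
    _ ≤ LinfVNorm a * vNorm p (Sstar f) := vNorm_const_mul_le hpos hA _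
    _ ≤ LinfVNorm a * (CS * vNormC p f) := by gcongr; exact hCS f hf hc
    _ = 1 * (CS : ℝ≥0∞) * LinfVNorm a * vNormC p f := by ring
    _ ≤ 2 * (CS : ℝ≥0∞) * LinfVNorm a * vNormC p f := by gcongr; norm_num
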